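/- Let A be an ℕ-graded K-algebra generated in degrees 0 and 1 and let * be a 0-equivariant star product on A such that f * a − fa ∈ A_{n−1} for all f ∈ A_1, n ∈ ℕ and a ∈ A_n (where A_{−1} := 0). For j ≥ 1 let A_1^{*j} denote the K-span of all j-fold star products x_1 * x_2 * ⋯ * x_j with x_1, …, x_j ∈ A_1, and set A_1^{*0} := A_0. Then A_m ⊆ Σ_{k=0}^{⌊m/2⌋} A_1^{*(m−2k)} for every m ∈ ℕ. -/

import Mathlib

/-- The set of `j`-fold star products `x₁ * x₂ * ⋯ * x_j` (bracketed from the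
right) with all factors in `A₁`; for `j = 0` we take `A₀` by convention. -/
def pureStarProducts {K A : Type*} [Field K] [Ring A] [Algebra K A]
    (𝒜 : ℕ → Submodule K A) (star : A →ₗ[K] A →ₗ[K] A) : ℕ → Set A
  | 0 => (𝒜 0 : Set A)
  | 1 => (𝒜 1 : Set A)
  | (j + 2) => {x : A | ∃ f ∈ 𝒜 1, ∃ p ∈ pureStarProducts 𝒜 star (j + 1), x = star f p}

/-- `A₁^{*j}`: the `K`-span of all `j`-fold star products of elements of `A₁`,
with `A₁^{*0} := A₀`. -/
def starPower {K A : Type*} [Field K] [Ring A] [Algebra K A]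
    (𝒜 : ℕ → Submodule K A) (star : A →ₗ[K] A →ₗ[K] A) (j : ℕ) : Submodule K A :=
  Submodule.span K (pureStarProducts 𝒜 star j)

open DirectSum in
/-- In an algebra generated in degrees `0` and `1`, every component of positive degree satisfies
`A_{n+1} ⊆ A₁ · A_n`. -/
theorem graded_succ_le_one_mul {K A : Type*} [Field K] [Ring A] [Algebra K A]
    (𝒜 : ℕ → Submodule K A) [GradedAlgebra 𝒜]
    (hgen : Algebra.adjoin K ((𝒜 0 : Set A) ∪ (𝒜 1 : Set A)) = ⊤) (n : ℕ) :
    𝒜 (n + 1) ≤ 𝒜 1 * 𝒜 n := by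
  have key : ∀ x : A, ∀ y : A, (∀ n, (decompose 𝒜 y (n + 1) : A) ∈ 𝒜 1 * 𝒜 n) →
      ∀ n, (decompose 𝒜 (x * y) (n + 1) : A) ∈ 𝒜 1 * 𝒜 n := by
    intro x
    have hx : x ∈ Algebra.adjoin K ((𝒜 0 : Set A) ∪ (𝒜 1 : Set A)) := hgen ▸ Algebra.mem_top
    induction hx using Algebra.adjoin_induction with
    | mem x hx =>
      intro y hy n
      rcases hx with hx | hx
      · have hmul := coe_decompose_mul_add_of_left_mem 𝒜 (j := n + 1) (b := y) hx
        rw [zero_add] at hmul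
        rw [hmul]
        refine Submodule.mul_induction_on (hy n) (fun f hf a ha => ?_) (fun a b ha hb => ?_)
        · rw [← mul_assoc]
          refine Submodule.mul_mem_mul ?_ ha
          simpa using SetLike.GradedMul.mul_mem hx hf
        · rw [mul_add]
          exact add_mem ha hb
      · rw [add_comm n 1, coe_decompose_mul_add_of_left_mem 𝒜 hx]
        exact Submodule.mul_mem_mul hx (SetLike.coe_mem _)
    | algebraMap r =>
      intro y hy n
      rw [← Algebra.smul_def, decompose_smul]
      exact Submodule.smul_mem _ r (hy n)
    | add x₁ x₂ _ _ h₁ h₂ =>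
      intro y hy n
      rw [add_mul, decompose_add]
      exact add_mem (h₁ y hy n) (h₂ y hy n)
    | mul x₁ x₂ _ _ h₁ h₂ =>
      intro y hy n
      rw [mul_assoc]
      exact h₁ _ (h₂ y hy) n
  intro a ha
  have h := key a 1 (fun k => by
    rw [decompose_of_mem_ne 𝒜 SetLike.GradedOne.one_mem (Nat.succ_ne_zero k).symm]
    exact zero_mem _) n
  rwa [mul_one, decompose_of_mem_same 𝒜 ha] at h

/-- Left star multiplication by an element of `A₁` maps `A₁^{*j}` into `A₁^{*(j+1)}`. -/
theorem star_mem_starPower_succ {K A : Type*} [Field K] [Ring A] [Algebra K A]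
    (𝒜 : ℕ → Submodule K A) [SetLike.GradedMonoid 𝒜] (star : A →ₗ[K] A →ₗ[K] A)
    (hstar : ∀ a, ∀ h ∈ 𝒜 0, star a h = a * h) {f : A} (hf : f ∈ 𝒜 1) (j : ℕ) :
    starPower 𝒜 star j ≤ (starPower 𝒜 star (j + 1)).comap (star f) := by
  refine Submodule.span_le.2 fun p hp => Submodule.subset_span ?_
  cases j with
  | zero =>
    have hp0 : p ∈ 𝒜 0 := hp
    change star f p ∈ 𝒜 1
    rw [hstar f p hp0]
    exact SetLike.GradedMul.mul_mem hf hp0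
  | succ j => exact ⟨f, hf, p, hp, rfl⟩

/-- Let `A` be an ℕ-graded `K`-algebra generated in degrees `0`
and `1`, and let `*` be a `0`-equivariant star product such that
`f * a - f·a ∈ A_{n-1}` for all `f ∈ A₁`, `a ∈ Aₙ`. Then
`A_m ⊆ Σ_{k=0}^{⌊m/2⌋} A₁^{*(m-2k)}` for all `m`. -/
theorem graded_component_in_star_powers
    {K A : Type*} [Field K] [Ring A] [Algebra K A]
    (𝒜 : ℕ → Submodule K A) [GradedAlgebra 𝒜]
    (hgen : Algebra.adjoin K ((𝒜 0 : Set A) ∪ (𝒜 1 : Set A)) = ⊤)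
    (star : A →ₗ[K] A →ₗ[K] A)
    (hassoc : ∀ a b c : A, star (star a b) c = star a (star b c))
    (hlow : ∀ (m n : ℕ) (a b : A), a ∈ 𝒜 m → b ∈ 𝒜 n →
      star a b - a * b ∈ ⨆ k < m + n, 𝒜 k)
    (h0eq : ∀ (h a : A), h ∈ 𝒜 0 → star a h = a * h ∧ star h a = h * a)
    (hmuL : ∀ f ∈ 𝒜 1, ∀ (n : ℕ), ∀ a ∈ 𝒜 n,
      star f a - f * a ∈ ⨆ (m : ℕ) (_ : m + 1 = n), 𝒜 m) :
    ∀ m : ℕ, 𝒜 m ≤ ⨆ k ≤ m / 2, starPower 𝒜 star (m - 2 * k) := by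
  intro m
  induction m using Nat.strong_induction_on with
  | _ m ih =>
  match m with
  | 0 => exact le_iSup₂_of_le 0 le_rfl Submodule.subset_span
  | 1 => exact le_iSup₂_of_le 0 (Nat.zero_le _) Submodule.subset_span
  | n + 2 =>
    refine (graded_succ_le_one_mul 𝒜 hgen (n + 1)).trans (Submodule.mul_le.2 fun f hf a ha => ?_)
    rw [← sub_sub_cancel (star f a) (f * a)]
    refine sub_mem ?_ ?_
    · have hle : (⨆ k ≤ (n + 1) / 2, starPower 𝒜 star (n + 1 - 2 * k)) ≤
          (⨆ k ≤ (n + 2) / 2, starPower 𝒜 star (n + 2 - 2 * k)).comap (star f) := by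
        refine iSup₂_le fun k hk => (star_mem_starPower_succ 𝒜 star
          (fun a h hh => (h0eq h a hh).1) hf _).trans (Submodule.comap_mono ?_)
        refine le_iSup₂_of_le k (by omega) (le_of_eq ?_)
        congr 1
        omega
      exact hle (ih (n + 1) (by omega) ha)
    · have hle : (⨆ (m : ℕ) (_ : m + 1 = n + 1), 𝒜 m) ≤
          ⨆ k ≤ (n + 2) / 2, starPower 𝒜 star (n + 2 - 2 * k) := by
        refine iSup₂_le fun m hm => ?_
        obtain rfl : m = n := by omega
        refine (ih m (by omega)).trans (iSup₂_le fun k hk => ?_)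
        refine le_iSup₂_of_le (k + 1) (by omega) (le_of_eq ?_)
        congr 1
        omega
      exact hle (hmuL f hf (n + 1) a ha)
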